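/- Let J be the superalgebra (2,2)₅. A bilinear map h : J × J → J is a supersymmetric 2-cocycle if and only if there exist α, β, γ, δ, ε, λ, θ ∈ F such that h(e₁,e₁) = αe₁ − βe₂, h(e₁,e₂) = γe₁ + βe₂, h(e₁,f₁) = δe₂ + αf₁, h(e₁,f₂) = εe₂ + αf₂, h(e₂,e₂) = −γe₁ + λe₂, h(e₂,f₁) = −δe₂ + γf₁, h(e₂,f₂) = −εe₂ + γf₂, h(f₁,f₂) = θe₁ − βe₂, h(f₁,f₁) = h(f₂,f₂) = 0, with the remaining basis values determined by supersymmetry (h(e₂,e₁) = h(e₁,e₂), h(fⱼ,eᵢ) = h(eᵢ,fⱼ), h(f₂,f₁) = −h(f₁,f₂)). -/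

import Mathlib

namespace JS22

variable (F : Type*) [Field F] [CharZero F]

/-- The underlying ℤ₂-graded vector space `J = F⁴`: coordinates `0,1` are the even
basis vectors `e₁, e₂` and coordinates `2,3` are the odd basis vectors `f₁, f₂`. -/
abbrev J : Type _ := Fin 4 → F

def e1 : J F := ![1, 0, 0, 0]
def e2 : J F := ![0, 1, 0, 0]
def f1 : J F := ![0, 0, 1, 0]
def f2 : J F := ![0, 0, 0, 1]

/-- The even part `J₀ = span {e₁, e₂}`. -/
def J0 : Submodule F (J F) := Submodule.span F {e1 F, e2 F}

/-- The odd part `J₁ = span {f₁, f₂}`. -/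
def J1 : Submodule F (J F) := Submodule.span F {f1 F, f2 F}

/-- `x` is homogeneous of degree `d ∈ {0, 1}`. -/
def IsHomog (x : J F) (d : ℕ) : Prop :=
  (d = 0 ∧ x ∈ J0 F) ∨ (d = 1 ∧ x ∈ J1 F)

/-- A (bilinear) multiplication is supercommutative: `x y = (−1)^{|x||y|} y x`. -/
def IsSuperComm (mul : J F → J F → J F) : Prop :=
  ∀ x y : J F, ∀ dx dy : ℕ, IsHomog F x dx → IsHomog F y dy →
    mul x y = ((-1 : F) ^ (dx * dy)) • mul y x

/-- The Jordan superidentity, for all homogeneous `w, x, y, z`. -/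
def SatisfiesJordanSuperId (mul : J F → J F → J F) : Prop :=
  ∀ w x y z : J F, ∀ dw dx dy dz : ℕ,
    IsHomog F w dw → IsHomog F x dx → IsHomog F y dy → IsHomog F z dz →
    mul (mul w x) (mul y z)
      + ((-1 : F) ^ (dx * dy)) • mul (mul w y) (mul x z)
      + ((-1 : F) ^ ((dx + dy) * dz)) • mul (mul w z) (mul x y)
      - ((-1 : F) ^ (dw * dx)) • mul x (mul w (mul y z))
      - ((-1 : F) ^ (dy * (dw + dx))) • mul y (mul w (mul x z))
      - ((-1 : F) ^ (dz * (dw + dx + dy))) • mul z (mul w (mul x y)) = 0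

/-- `F(a,b,c,d) = h((ab)c, d) + h(ab,c)·d + (h(a,b)·c)·d`. -/
def Fc (mul : J F → J F → J F) (h : J F →ₗ[F] J F →ₗ[F] J F) (a b c d : J F) : J F :=
  h (mul (mul a b) c) d + mul (h (mul a b) c) d + mul (mul (h a b) c) d

/-- `G(a,b,c,d) = h(ab, cd) + h(a,b)·(cd) + (ab)·h(c,d)`. -/
def Gc (mul : J F → J F → J F) (h : J F →ₗ[F] J F →ₗ[F] J F) (a b c d : J F) : J F :=
  h (mul a b) (mul c d) + mul (h a b) (mul c d) + mul (mul a b) (h c d)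

/-- Supersymmetry of `h`: `h(a,b) = (−1)^{|a||b|} h(b,a)` for homogeneous `a, b`. -/
def IsSuperSym (h : J F →ₗ[F] J F →ₗ[F] J F) : Prop :=
  ∀ a b : J F, ∀ da db : ℕ, IsHomog F a da → IsHomog F b db →
    h a b = ((-1 : F) ^ (da * db)) • h b a

/-- The 2-cocycle identity for `h` with respect to the multiplication `mul`. -/
def IsCocycleId (mul : J F → J F → J F) (h : J F →ₗ[F] J F →ₗ[F] J F) : Prop :=
  ∀ a b c d : J F, ∀ da db dc dd : ℕ,
    IsHomog F a da → IsHomog F b db → IsHomog F c dc → IsHomog F d dd →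
    Fc F mul h a b c d + ((-1 : F) ^ (db * (dc + dd) + dc * dd)) • Fc F mul h a d c b
      + ((-1 : F) ^ (da * (db + dc + dd) + dc * dd)) • Fc F mul h b d c a
    = Gc F mul h a b c d + ((-1 : F) ^ (db * dc)) • Gc F mul h a c b d
      + ((-1 : F) ^ (dd * (dc + db))) • Gc F mul h a d b c

/-- `h` is a supersymmetric 2-cocycle. -/
def IsSuperCocycle (mul : J F → J F → J F) (h : J F →ₗ[F] J F →ₗ[F] J F) : Prop :=
  IsSuperSym F h ∧ IsCocycleId F mul h

/-- `h` is a coboundary: `h(a,b) = a·μ(b) + μ(a)·b − μ(a·b)` for some linear `μ`. -/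
def IsCoboundary (mul : J F → J F → J F) (h : J F →ₗ[F] J F →ₗ[F] J F) : Prop :=
  ∃ μ : J F →ₗ[F] J F, ∀ a b : J F, h a b = mul a (μ b) + mul (μ a) b - μ (mul a b)

/-- The bilinear map `h` is even: `h(J_i × J_j) ⊆ J_{i+j}`. -/
def IsEvenBilin (h : J F →ₗ[F] J F →ₗ[F] J F) : Prop :=
  (∀ a ∈ J0 F, ∀ b ∈ J0 F, h a b ∈ J0 F) ∧
  (∀ a ∈ J0 F, ∀ b ∈ J1 F, h a b ∈ J1 F) ∧
  (∀ a ∈ J1 F, ∀ b ∈ J0 F, h a b ∈ J1 F) ∧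
  (∀ a ∈ J1 F, ∀ b ∈ J1 F, h a b ∈ J0 F)

/-- The linear map `μ` is even: `μ(J_i) ⊆ J_i`. -/
def IsEvenLin (μ : J F →ₗ[F] J F) : Prop :=
  (∀ a ∈ J0 F, μ a ∈ J0 F) ∧ (∀ a ∈ J1 F, μ a ∈ J1 F)

/-- `φ` is a graded algebra isomorphism from `(J, mulA)` onto `(J, mulB)`. -/
def IsGradedIso (mulA mulB : J F → J F → J F) (φ : J F → J F) : Prop :=
  IsLinearMap F φ ∧ Function.Bijective φ ∧
  φ '' (J0 F : Set (J F)) = (J0 F : Set (J F)) ∧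
  φ '' (J1 F : Set (J F)) = (J1 F : Set (J F)) ∧
  ∀ x y : J F, φ (mulA x y) = mulB (φ x) (φ y)

/-- `D_γ`: `e₁²=e₁`, `e₂²=e₂`, `eᵢfⱼ = ½fⱼ`, `f₁f₂ = e₁ + γe₂`. -/
def mulD (γ : F) (x y : J F) : J F :=
  ![x 0 * y 0 + (x 2 * y 3 - x 3 * y 2),
    x 1 * y 1 + γ * (x 2 * y 3 - x 3 * y 2),
    ((x 0 + x 1) * y 2 + x 2 * (y 0 + y 1)) / 2,
    ((x 0 + x 1) * y 3 + x 3 * (y 0 + y 1)) / 2]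

/-- `(2,2)₁`: `e₁²=e₁`, `e₂²=e₂`. -/
def mul1 (x y : J F) : J F :=
  ![x 0 * y 0, x 1 * y 1, 0, 0]

/-- `(2,2)₃`: `e₁²=e₁`, `e₂²=e₂`, `e₁f₁=½f₁`, `e₁f₂=½f₂`, `f₁f₂=e₁`. -/
def mul3 (x y : J F) : J F :=
  ![x 0 * y 0 + (x 2 * y 3 - x 3 * y 2), x 1 * y 1,
    (x 0 * y 2 + x 2 * y 0) / 2, (x 0 * y 3 + x 3 * y 0) / 2]

/-- `(2,2)₅`: `e₁²=e₁`, `e₂²=e₂`, `e₁f₁=f₁`, `e₁f₂=f₂`, `f₁f₂=e₁`. -/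
def mul5 (x y : J F) : J F :=
  ![x 0 * y 0 + (x 2 * y 3 - x 3 * y 2), x 1 * y 1,
    x 0 * y 2 + x 2 * y 0, x 0 * y 3 + x 3 * y 0]

/-- `(2,2)₇`: `e₁²=e₁`, `e₂²=e₂`, `eᵢfⱼ=½fⱼ`, `f₁f₂=e₂`. -/
def mul7 (x y : J F) : J F :=
  ![x 0 * y 0, x 1 * y 1 + (x 2 * y 3 - x 3 * y 2),
    ((x 0 + x 1) * y 2 + x 2 * (y 0 + y 1)) / 2,
    ((x 0 + x 1) * y 3 + x 3 * (y 0 + y 1)) / 2]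

/-- `(2,2)₈`: `e₁²=e₁`, `e₂²=e₂`, `e₁f₁=½f₁`. -/
def mul8 (x y : J F) : J F :=
  ![x 0 * y 0, x 1 * y 1, (x 0 * y 2 + x 2 * y 0) / 2, 0]

/-- `(2,2)₂₆`: `e₁²=e₁`, `e₁f₁=½f₁`, `e₁f₂=½f₂`, `f₁f₂=e₁+e₂`. -/
def mul26 (x y : J F) : J F :=
  ![x 0 * y 0 + (x 2 * y 3 - x 3 * y 2), x 2 * y 3 - x 3 * y 2,
    (x 0 * y 2 + x 2 * y 0) / 2, (x 0 * y 3 + x 3 * y 0) / 2]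

/-- `(2,2)₄₃`: `e₁²=e₁`, `e₁e₂=e₂`, `e₁f₁=f₁`, `e₁f₂=f₂`, `f₁f₂=e₁+e₂`. -/
def mul43 (x y : J F) : J F :=
  ![x 0 * y 0 + (x 2 * y 3 - x 3 * y 2),
    x 0 * y 1 + x 1 * y 0 + (x 2 * y 3 - x 3 * y 2),
    x 0 * y 2 + x 2 * y 0, x 0 * y 3 + x 3 * y 0]

/-- `(2,2)₅₂`: `e₁²=e₁`, `e₁e₂=½e₂`. -/
def mul52 (x y : J F) : J F :=
  ![x 0 * y 0, (x 0 * y 1 + x 1 * y 0) / 2, 0, 0]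

/-- `(2,2)₅₇`: `e₁²=e₁`, `e₁e₂=½e₂`, `e₁f₂=f₂`. -/
def mul57 (x y : J F) : J F :=
  ![x 0 * y 0, (x 0 * y 1 + x 1 * y 0) / 2, 0, x 0 * y 3 + x 3 * y 0]

/-- `(2,2)₆₀`: `e₁²=e₁`, `e₁e₂=½e₂`, `e₁f₁=½f₁`, `e₁f₂=½f₂`. -/
def mul60 (x y : J F) : J F :=
  ![x 0 * y 0, (x 0 * y 1 + x 1 * y 0) / 2,
    (x 0 * y 2 + x 2 * y 0) / 2, (x 0 * y 3 + x 3 * y 0) / 2]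

/-- `(2,2)₆₇`: `e₁²=e₁`, `e₁e₂=½e₂`, `e₁f₁=f₁`, `e₁f₂=f₂`. -/
def mul67 (x y : J F) : J F :=
  ![x 0 * y 0, (x 0 * y 1 + x 1 * y 0) / 2,
    x 0 * y 2 + x 2 * y 0, x 0 * y 3 + x 3 * y 0]

set_option linter.unusedSectionVars false
set_option linter.unusedSimpArgs false

theorem mem_J0_elim {x : J F} (hx : x ∈ J0 F) : ∃ p q : F, x = ![p, q, 0, 0] := by
  rw [J0, Submodule.mem_span_pair] at hx
  obtain ⟨p, q, rfl⟩ := hx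
  exact ⟨p, q, by ext i; fin_cases i <;> simp [e1, e2]⟩

theorem mem_J1_elim {x : J F} (hx : x ∈ J1 F) : ∃ p q : F, x = ![0, 0, p, q] := by
  rw [J1, Submodule.mem_span_pair] at hx
  obtain ⟨p, q, rfl⟩ := hx
  exact ⟨p, q, by ext i; fin_cases i <;> simp [f1, f2]⟩

theorem decomp (x : J F) :
    x = x 0 • e1 F + x 1 • e2 F + x 2 • f1 F + x 3 • f2 F := by
  ext i; fin_cases i <;> simp [e1, e2, f1, f2]

theorem bilin_expand (h : J F →ₗ[F] J F →ₗ[F] J F) (x y : J F) :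
    h x y =
      x 0 • (y 0 • h (e1 F) (e1 F) + y 1 • h (e1 F) (e2 F)
        + y 2 • h (e1 F) (f1 F) + y 3 • h (e1 F) (f2 F))
      + x 1 • (y 0 • h (e2 F) (e1 F) + y 1 • h (e2 F) (e2 F)
        + y 2 • h (e2 F) (f1 F) + y 3 • h (e2 F) (f2 F))
      + x 2 • (y 0 • h (f1 F) (e1 F) + y 1 • h (f1 F) (e2 F)
        + y 2 • h (f1 F) (f1 F) + y 3 • h (f1 F) (f2 F))
      + x 3 • (y 0 • h (f2 F) (e1 F) + y 1 • h (f2 F) (e2 F)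
        + y 2 • h (f2 F) (f1 F) + y 3 • h (f2 F) (f2 F)) := by
  conv_lhs => rw [decomp F x, decomp F y]
  simp only [map_add, map_smul, LinearMap.add_apply, LinearMap.smul_apply]
  module

/-- The explicit normal form of the cocycles. -/
def nf (α β γ δ ε lam θ : F) (x y : J F) : J F :=
  ![α * (x 0 * y 0) + γ * (x 0 * y 1 + x 1 * y 0) - γ * (x 1 * y 1)
      + θ * (x 2 * y 3 - x 3 * y 2),
    -β * (x 0 * y 0) + β * (x 0 * y 1 + x 1 * y 0) + lam * (x 1 * y 1)
      - β * (x 2 * y 3 - x 3 * y 2)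
      + δ * (x 0 * y 2 + x 2 * y 0 - x 1 * y 2 - x 2 * y 1)
      + ε * (x 0 * y 3 + x 3 * y 0 - x 1 * y 3 - x 3 * y 1),
    α * (x 0 * y 2 + x 2 * y 0) + γ * (x 1 * y 2 + x 2 * y 1),
    α * (x 0 * y 3 + x 3 * y 0) + γ * (x 1 * y 3 + x 3 * y 1)]

theorem hom_e1 : IsHomog F (e1 F) 0 := Or.inl ⟨rfl, Submodule.subset_span (by simp)⟩
theorem hom_e2 : IsHomog F (e2 F) 0 := Or.inl ⟨rfl, Submodule.subset_span (by simp)⟩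
theorem hom_f1 : IsHomog F (f1 F) 1 := Or.inr ⟨rfl, Submodule.subset_span (by simp)⟩
theorem hom_f2 : IsHomog F (f2 F) 1 := Or.inr ⟨rfl, Submodule.subset_span (by simp)⟩

theorem m11 : mul5 F (e1 F) (e1 F) = e1 F := by ext i; fin_cases i <;> simp [mul5, e1]
theorem m12 : mul5 F (e1 F) (e2 F) = 0 := by ext i; fin_cases i <;> simp [mul5, e1, e2]
theorem m21 : mul5 F (e2 F) (e1 F) = 0 := by ext i; fin_cases i <;> simp [mul5, e1, e2]
theorem m22 : mul5 F (e2 F) (e2 F) = e2 F := by ext i; fin_cases i <;> simp [mul5, e2]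
theorem m13 : mul5 F (e1 F) (f1 F) = f1 F := by ext i; fin_cases i <;> simp [mul5, e1, f1]
theorem m31 : mul5 F (f1 F) (e1 F) = f1 F := by ext i; fin_cases i <;> simp [mul5, e1, f1]
theorem m14 : mul5 F (e1 F) (f2 F) = f2 F := by ext i; fin_cases i <;> simp [mul5, e1, f2]
theorem m41 : mul5 F (f2 F) (e1 F) = f2 F := by ext i; fin_cases i <;> simp [mul5, e1, f2]
theorem m23 : mul5 F (e2 F) (f1 F) = 0 := by ext i; fin_cases i <;> simp [mul5, e2, f1]
theorem m32 : mul5 F (f1 F) (e2 F) = 0 := by ext i; fin_cases i <;> simp [mul5, e2, f1]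
theorem m24 : mul5 F (e2 F) (f2 F) = 0 := by ext i; fin_cases i <;> simp [mul5, e2, f2]
theorem m42 : mul5 F (f2 F) (e2 F) = 0 := by ext i; fin_cases i <;> simp [mul5, e2, f2]
theorem m33 : mul5 F (f1 F) (f1 F) = 0 := by ext i; fin_cases i <;> simp [mul5, f1]
theorem m44 : mul5 F (f2 F) (f2 F) = 0 := by ext i; fin_cases i <;> simp [mul5, f2]
theorem m34 : mul5 F (f1 F) (f2 F) = e1 F := by
  ext i; fin_cases i <;> simp [mul5, f1, f2, e1]
theorem m43 : mul5 F (f2 F) (f1 F) = - e1 F := by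
  ext i; fin_cases i <;> simp [mul5, f1, f2, e1]
theorem m0l (x : J F) : mul5 F 0 x = 0 := by ext i; fin_cases i <;> simp [mul5]
theorem m0r (x : J F) : mul5 F x 0 = 0 := by ext i; fin_cases i <;> simp [mul5]
theorem mnl (x y : J F) : mul5 F (-x) y = - mul5 F x y := by
  ext i; fin_cases i <;> simp [mul5] <;> ring
theorem mnr (x y : J F) : mul5 F x (-y) = - mul5 F x y := by
  ext i; fin_cases i <;> simp [mul5] <;> ring

theorem xe1 (x : J F) : mul5 F x (e1 F) = ![x 0, 0, x 2, x 3] := by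
  ext i; fin_cases i <;> simp [mul5, e1]
theorem xe2 (x : J F) : mul5 F x (e2 F) = ![0, x 1, 0, 0] := by
  ext i; fin_cases i <;> simp [mul5, e2]
theorem xf1 (x : J F) : mul5 F x (f1 F) = ![-x 3, 0, x 0, 0] := by
  ext i; fin_cases i <;> simp [mul5, f1]
theorem xf2 (x : J F) : mul5 F x (f2 F) = ![x 2, 0, 0, x 0] := by
  ext i; fin_cases i <;> simp [mul5, f2]
theorem e1x (x : J F) : mul5 F (e1 F) x = ![x 0, 0, x 2, x 3] := by
  ext i; fin_cases i <;> simp [mul5, e1]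
theorem e2x (x : J F) : mul5 F (e2 F) x = ![0, x 1, 0, 0] := by
  ext i; fin_cases i <;> simp [mul5, e2]
theorem f1x (x : J F) : mul5 F (f1 F) x = ![x 3, 0, x 0, 0] := by
  ext i; fin_cases i <;> simp [mul5, f1]
theorem f2x (x : J F) : mul5 F (f2 F) x = ![-x 2, 0, 0, x 0] := by
  ext i; fin_cases i <;> simp [mul5, f2]

theorem nf_sym (h : J F →ₗ[F] J F →ₗ[F] J F) (α β γ δ ε lam θ : F)
    (H : ∀ x y, h x y = nf F α β γ δ ε lam θ x y) : IsSuperSym F h := by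
  rintro a b da db (⟨rfl, ha⟩ | ⟨rfl, ha⟩) (⟨rfl, hb⟩ | ⟨rfl, hb⟩)
  all_goals
    first
    | obtain ⟨a1, a2, rfl⟩ := mem_J0_elim F ha
    | obtain ⟨a1, a2, rfl⟩ := mem_J1_elim F ha
    first
    | obtain ⟨b1, b2, rfl⟩ := mem_J0_elim F hb
    | obtain ⟨b1, b2, rfl⟩ := mem_J1_elim F hb
    rw [H, H]
    ext i
    fin_cases i <;> simp [nf] <;> ring

theorem mul5_vec (a b c d p q r s : F) : mul5 F ![a, b, c, d] ![p, q, r, s] =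
    ![a * p + (c * s - d * r), b * q, a * r + c * p, a * s + d * p] := rfl

theorem nf_vec (α β γ δ ε lam θ a b c d p q r s : F) :
    nf F α β γ δ ε lam θ ![a, b, c, d] ![p, q, r, s] =
    ![α * (a * p) + γ * (a * q + b * p) - γ * (b * q) + θ * (c * s - d * r),
      -β * (a * p) + β * (a * q + b * p) + lam * (b * q) - β * (c * s - d * r)
        + δ * (a * r + c * p - b * r - c * q) + ε * (a * s + d * p - b * s - d * q),
      α * (a * r + c * p) + γ * (b * r + c * q),
      α * (a * s + d * p) + γ * (b * s + d * q)] := rfl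

theorem vec_add (a b c d p q r s : F) :
    (![a, b, c, d] + ![p, q, r, s] : J F) = ![a + p, b + q, c + r, d + s] := by simp

theorem vec_smul (t a b c d : F) :
    (t • ![a, b, c, d] : J F) = ![t * a, t * b, t * c, t * d] := by simp

theorem vec_ext {a b c d p q r s : F} (h0 : a = p) (h1 : b = q) (h2 : c = r) (h3 : d = s) :
    (![a, b, c, d] : J F) = ![p, q, r, s] := by rw [h0, h1, h2, h3]

set_option maxHeartbeats 4000000 in
theorem nf_cocycle (h : J F →ₗ[F] J F →ₗ[F] J F) (α β γ δ ε lam θ : F)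
    (H : ∀ x y, h x y = nf F α β γ δ ε lam θ x y) : IsCocycleId F (mul5 F) h := by
  rintro a b c d da db dc dd (⟨rfl, ha⟩ | ⟨rfl, ha⟩) (⟨rfl, hb⟩ | ⟨rfl, hb⟩)
    (⟨rfl, hc⟩ | ⟨rfl, hc⟩) (⟨rfl, hd⟩ | ⟨rfl, hd⟩)
  all_goals
    first
    | obtain ⟨a1, a2, rfl⟩ := mem_J0_elim F ha
    | obtain ⟨a1, a2, rfl⟩ := mem_J1_elim F ha
    first
    | obtain ⟨b1, b2, rfl⟩ := mem_J0_elim F hb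
    | obtain ⟨b1, b2, rfl⟩ := mem_J1_elim F hb
    first
    | obtain ⟨c1, c2, rfl⟩ := mem_J0_elim F hc
    | obtain ⟨c1, c2, rfl⟩ := mem_J1_elim F hc
    first
    | obtain ⟨d1, d2, rfl⟩ := mem_J0_elim F hd
    | obtain ⟨d1, d2, rfl⟩ := mem_J1_elim F hd
    simp only [Fc, Gc, H, mul5_vec, nf_vec, mul_zero, zero_mul, add_zero, zero_add,
      sub_zero, zero_sub, sub_self, neg_zero]
    simp only [vec_add, vec_smul, mul_zero, zero_mul, add_zero, zero_add]
    refine vec_ext F ?_ ?_ ?_ ?_ <;> ring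

set_option maxHeartbeats 4000000 in
/-- description of all supersymmetric 2-cocycles of `(2,2)₅`. -/
theorem cocycles_of_mul5 (h : J F →ₗ[F] J F →ₗ[F] J F) :
    IsSuperCocycle F (mul5 F) h ↔
    ∃ α β γ δ ε lam θ : F,
      h (e1 F) (e1 F) = α • e1 F - β • e2 F ∧
      h (e1 F) (e2 F) = γ • e1 F + β • e2 F ∧
      h (e1 F) (f1 F) = δ • e2 F + α • f1 F ∧
      h (e1 F) (f2 F) = ε • e2 F + α • f2 F ∧
      h (e2 F) (e2 F) = (-γ) • e1 F + lam • e2 F ∧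
      h (e2 F) (f1 F) = (-δ) • e2 F + γ • f1 F ∧
      h (e2 F) (f2 F) = (-ε) • e2 F + γ • f2 F ∧
      h (f1 F) (f2 F) = θ • e1 F - β • e2 F ∧

      h (f1 F) (f1 F) = 0 ∧ h (f2 F) (f2 F) = 0 ∧
      h (e2 F) (e1 F) = h (e1 F) (e2 F) ∧
      h (f1 F) (e1 F) = h (e1 F) (f1 F) ∧ h (f2 F) (e1 F) = h (e1 F) (f2 F) ∧
      h (f1 F) (e2 F) = h (e2 F) (f1 F) ∧ h (f2 F) (e2 F) = h (e2 F) (f2 F) ∧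
      h (f2 F) (f1 F) = - h (f1 F) (f2 F) := by
  constructor
  · rintro ⟨hs, hc⟩
    have two : (2 : F) ≠ 0 := two_ne_zero
    have s10 : h (e2 F) (e1 F) = h (e1 F) (e2 F) := by
      simpa using hs _ _ _ _ (hom_e2 F) (hom_e1 F)
    have s20 : h (f1 F) (e1 F) = h (e1 F) (f1 F) := by
      simpa using hs _ _ _ _ (hom_f1 F) (hom_e1 F)
    have s30 : h (f2 F) (e1 F) = h (e1 F) (f2 F) := by
      simpa using hs _ _ _ _ (hom_f2 F) (hom_e1 F)
    have s21 : h (f1 F) (e2 F) = h (e2 F) (f1 F) := by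
      simpa using hs _ _ _ _ (hom_f1 F) (hom_e2 F)
    have s31 : h (f2 F) (e2 F) = h (e2 F) (f2 F) := by
      simpa using hs _ _ _ _ (hom_f2 F) (hom_e2 F)
    have s32 : h (f2 F) (f1 F) = -h (f1 F) (f2 F) := by
      simpa using hs _ _ _ _ (hom_f2 F) (hom_f1 F)
    have s22 : h (f1 F) (f1 F) = 0 := by
      have := hs _ _ _ _ (hom_f1 F) (hom_f1 F)
      simp only [mul_one, pow_one, neg_smul, one_smul] at this
      exact self_eq_neg.mp this
    have s33 : h (f2 F) (f2 F) = 0 := by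
      have := hs _ _ _ _ (hom_f2 F) (hom_f2 F)
      simp only [mul_one, pow_one, neg_smul, one_smul] at this
      exact self_eq_neg.mp this
    have c0001 := hc _ _ _ _ _ _ _ _ (hom_e1 F) (hom_e1 F) (hom_e1 F) (hom_e2 F)
    have c0002 := hc _ _ _ _ _ _ _ _ (hom_e1 F) (hom_e1 F) (hom_e1 F) (hom_f1 F)
    have c0003 := hc _ _ _ _ _ _ _ _ (hom_e1 F) (hom_e1 F) (hom_e1 F) (hom_f2 F)
    have c0011 := hc _ _ _ _ _ _ _ _ (hom_e1 F) (hom_e1 F) (hom_e2 F) (hom_e2 F)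
    have c0012 := hc _ _ _ _ _ _ _ _ (hom_e1 F) (hom_e1 F) (hom_e2 F) (hom_f1 F)
    have c0013 := hc _ _ _ _ _ _ _ _ (hom_e1 F) (hom_e1 F) (hom_e2 F) (hom_f2 F)
    have c0020 := hc _ _ _ _ _ _ _ _ (hom_e1 F) (hom_e1 F) (hom_f1 F) (hom_e1 F)
    have c0021 := hc _ _ _ _ _ _ _ _ (hom_e1 F) (hom_e1 F) (hom_f1 F) (hom_e2 F)
    have c0023 := hc _ _ _ _ _ _ _ _ (hom_e1 F) (hom_e1 F) (hom_f1 F) (hom_f2 F)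
    have c0031 := hc _ _ _ _ _ _ _ _ (hom_e1 F) (hom_e1 F) (hom_f2 F) (hom_e2 F)
    have c2023 := hc _ _ _ _ _ _ _ _ (hom_f1 F) (hom_e1 F) (hom_f1 F) (hom_f2 F)
    have c3023 := hc _ _ _ _ _ _ _ _ (hom_f2 F) (hom_e1 F) (hom_f1 F) (hom_f2 F)
    simp only [Fc, Gc, m11, m12, m21, m22, m13, m31, m14, m41, m23, m32, m24, m42, m33, m44,
      m34, m43, m0l, m0r, mnl, mnr, map_zero, map_neg, LinearMap.zero_apply, LinearMap.neg_apply,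
      s10, s20, s30, s21, s31, s32, s22, s33] at c0001 c0002 c0003 c0011 c0012 c0013 c0020 c0021 c0023 c0031 c2023 c3023
    generalize h (e1 F) (e1 F) = w00 at *
    generalize h (e1 F) (e2 F) = w01 at *
    generalize h (e1 F) (f1 F) = w02 at *
    generalize h (e1 F) (f2 F) = w03 at *
    generalize h (e2 F) (e2 F) = w11 at *
    generalize h (e2 F) (f1 F) = w12 at *
    generalize h (e2 F) (f2 F) = w13 at *
    generalize h (f1 F) (f2 F) = w23 at *
    clear hs hc
    simp only [xe1, xe2, xf1, xf2, e1x, e2x, f1x, f2x] at c0001 c0002 c0003 c0011 c0012 c0013 c0020 c0021 c0023 c0031 c2023 c3023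
    simp [funext_iff, Fin.forall_fin_succ, Matrix.vecHead, Matrix.vecTail] at c0001 c0002 c0003 c0011 c0012 c0013 c0020 c0021 c0023 c0031 c2023 c3023
    have z232 : w23 2 = 0 := by linear_combination (1 / 2 : F) * c3023.1
    refine ⟨w00 0, -w00 1, w01 0, w02 1, w03 1, w11 1, w23 0, ?_, ?_, ?_, ?_, ?_, ?_, ?_, ?_,
      s22, s33, s10, s20, s30, s21, s31, s32⟩
    all_goals
      clear s22 s33 s10 s20 s30 s21 s31 s32
      ext i
      fin_cases i <;> simp [e1, e2, f1, f2] <;> grind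
  · rintro ⟨α, β, γ, δ, ε, lam, θ, h1, h2, h3, h4, h5, h6, h7, h8, h9, h10, h11, h12, h13, h14,
      h15, h16⟩
    have H : ∀ x y, h x y = nf F α β γ δ ε lam θ x y := by
      intro x y
      rw [bilin_expand, h16, h15, h14, h13, h12, h11, h10, h9, h8, h7, h6, h5, h4, h3, h2, h1]
      ext i
      fin_cases i <;> simp [nf, e1, e2, f1, f2] <;> ring
    exact ⟨nf_sym F h α β γ δ ε lam θ H, nf_cocycle F h α β γ δ ε lam θ H⟩

end JS22
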